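/- arXiv:2405.20586 — 2 statements merged into one kernel-verified Lean document; each statement's English description precedes it below -/
import Mathlib

section
/- For a quantum state ensemble E = {(η_i, ρ_i)}_{i=1}^n on a finite-dimensional Hilbert space and each j ∈ {1,...,n}, the maximum confidence over all measurements satisfies C_j(E) = max over measurements {M_i}_{i=0}^n with Tr(ρ_0 M_j) ≠ 0 of η_j Tr(ρ_j M_j)/Tr(ρ_0 M_j) = min{ q ∈ ℝ : qρ_0 − η_j ρ_j is positive semidefinite }, where ρ_0 = Σ_i η_i ρ_i. -/
open ComplexOrder

/-- A density matrix: positive semidefinite with unit trace. -/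
def IsState {ι : Type*} [Fintype ι] (ρ : Matrix ι ι ℂ) : Prop :=
  ρ.PosSemidef ∧ ρ.trace = 1

open Matrix in
/-- The trace of a product of two positive semidefinite matrices is nonnegative. -/
theorem Matrix.PosSemidef.trace_mul_nonneg {ι : Type*} [Fintype ι] {A B : Matrix ι ι ℂ}
    (hA : A.PosSemidef) (hB : B.PosSemidef) : 0 ≤ (A * B).trace := by
  obtain ⟨m, v, rfl⟩ := posSemidef_iff_eq_sum_vecMulVec.mp hB
  simp_rw [Finset.mul_sum, trace_sum, mul_vecMulVec, trace_vecMulVec, dotProduct_comm _ (star _)]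
  exact Finset.sum_nonneg fun i _ ↦ hA.dotProduct_mulVec_nonneg (v i)

open Matrix in
/-- The kernel of a positive semidefinite matrix is contained in that of any smaller one. -/
theorem Matrix.PosSemidef.mulVec_eq_zero_of_sub {ι : Type*} [Fintype ι] {A B : Matrix ι ι ℂ}
    (hB : B.PosSemidef) (hAB : (A - B).PosSemidef) {x : ι → ℂ} (hx : A *ᵥ x = 0) :
    B *ᵥ x = 0 := by
  have h := hAB.dotProduct_mulVec_nonneg x
  rw [sub_mulVec, hx, zero_sub, dotProduct_neg, neg_nonneg] at h
  exact (hB.dotProduct_mulVec_zero_iff x).mp (h.antisymm (hB.dotProduct_mulVec_nonneg x))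

open Matrix in
/-- If `ker A ⊆ ker B`, the generalized Rayleigh quotient of `B` relative to `A ≠ 0` attains its
maximum `c`, at some vector `v`, and `c • A - B` is positive semidefinite. -/
theorem Matrix.PosSemidef.exists_isMax_rayleighQuotient {ι : Type*} [Fintype ι]
    {A B : Matrix ι ι ℂ} (hA : A.PosSemidef) (hB : B.IsHermitian) (hA0 : A ≠ 0)
    (hker : ∀ x, A *ᵥ x = 0 → B *ᵥ x = 0) :
    ∃ (c : ℝ) (v : ι → ℂ), star v ⬝ᵥ A *ᵥ v ≠ 0 ∧
      star v ⬝ᵥ ((c : ℂ) • A - B) *ᵥ v = 0 ∧ ((c : ℂ) • A - B).PosSemidef := by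
  obtain ⟨W, hW⟩ := (LinearMap.ker A.mulVecLin).exists_isCompl
  have im_eq_zero {M : Matrix ι ι ℂ} (hM : M.IsHermitian) (x : ι → ℂ) :
      (star x ⬝ᵥ M *ᵥ x).im = 0 := hM.im_star_dotProduct_mulVec_self x
  have hpos : ∀ w ∈ W, w ≠ 0 → 0 < (star w ⬝ᵥ A *ᵥ w).re := by
    intro w hw hw0
    refine lt_of_le_of_ne (hA.re_dotProduct_nonneg w) fun h ↦ hw0 ?_
    have h0 : star w ⬝ᵥ A *ᵥ w = 0 := Complex.ext h.symm (im_eq_zero hA.1 w)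
    exact Submodule.disjoint_def.mp hW.disjoint w ((hA.dotProduct_mulVec_zero_iff w).mp h0) hw
  have hcont (M : Matrix ι ι ℂ) : Continuous fun x : ι → ℂ ↦ (star x ⬝ᵥ M *ᵥ x).re :=
    Complex.continuous_re.comp
      (continuous_star.dotProduct (continuous_const.matrix_mulVec continuous_id))
  have hne : ∃ w ∈ W, w ≠ 0 := by
    refine W.ne_bot_iff.mp fun h ↦ hA0 ?_
    have hk := hW.codisjoint.eq_top
    rw [h, sup_bot_eq] at hk
    exact mulVec_injective (by
      funext x
      have : x ∈ LinearMap.ker A.mulVecLin := hk ▸ Submodule.mem_top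
      simpa using this)
  have hcompact : IsCompact (Metric.sphere (0 : ι → ℂ) 1 ∩ W) :=
    (isCompact_sphere _ _).inter_right W.closed_of_finiteDimensional
  have hunit : ∀ w ∈ W, w ≠ 0 → ((‖w‖⁻¹ : ℝ) : ℂ) • w ∈ Metric.sphere (0 : ι → ℂ) 1 ∩ W := by
    intro w hw hw0
    refine ⟨?_, W.smul_mem _ hw⟩
    simp [norm_smul, hw0]
  obtain ⟨v, ⟨hv1, hvW⟩, hvmax⟩ := hcompact.exists_isMaxOn
    (f := fun x ↦ (star x ⬝ᵥ B *ᵥ x).re / (star x ⬝ᵥ A *ᵥ x).re)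
    (let ⟨w, hw, hw0⟩ := hne; ⟨_, hunit w hw hw0⟩)
    ((hcont B).continuousOn.div (hcont A).continuousOn fun x hx ↦
      (hpos x hx.2 (ne_zero_of_mem_unit_sphere ⟨x, hx.1⟩)).ne')
  have hvA := hpos v hvW (ne_zero_of_mem_unit_sphere ⟨v, hv1⟩)
  set c : ℝ := (star v ⬝ᵥ B *ᵥ v).re / (star v ⬝ᵥ A *ᵥ v).re with hc
  have hH : ((c : ℂ) • A - B).IsHermitian :=
    (hA.1.smul (by simp [IsSelfAdjoint])).sub hB
  have hre (x : ι → ℂ) : (star x ⬝ᵥ ((c : ℂ) • A - B) *ᵥ x).re =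
      c * (star x ⬝ᵥ A *ᵥ x).re - (star x ⬝ᵥ B *ᵥ x).re := by
    simp [sub_mulVec, smul_mulVec]
  have hquad (M : Matrix ι ι ℂ) (r : ℝ) (x : ι → ℂ) :
      (star ((r : ℂ) • x) ⬝ᵥ M *ᵥ ((r : ℂ) • x)).re = r ^ 2 * (star x ⬝ᵥ M *ᵥ x).re := by
    simp [mulVec_smul, sq, mul_assoc]
  have hWnonneg : ∀ w ∈ W, 0 ≤ (star w ⬝ᵥ ((c : ℂ) • A - B) *ᵥ w).re := by
    intro w hw
    rcases eq_or_ne w 0 with rfl | hw0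
    · simp
    have h : _ ≤ c := hvmax (hunit w hw hw0)
    simp only [hquad] at h
    rw [mul_div_mul_left _ _ (by simpa using hw0), div_le_iff₀ (hpos w hw hw0)] at h
    rw [hre]
    exact sub_nonneg.mpr h
  refine ⟨c, v, fun h ↦ hvA.ne' (by simp [h]), Complex.ext ?_ (im_eq_zero hH v),
    .of_dotProduct_mulVec_nonneg hH fun x ↦ ?_⟩
  · rw [hre, hc, div_mul_cancel₀ _ hvA.ne', sub_self, Complex.zero_re]
  · obtain ⟨k, hk, w, hw, rfl⟩ : ∃ k ∈ LinearMap.ker A.mulVecLin, ∃ w ∈ W, k + w = x :=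
      Submodule.mem_sup.mp (hW.codisjoint.eq_top ▸ Submodule.mem_top)
    have hAk : A *ᵥ k = 0 := hk
    have hMk : ((c : ℂ) • A - B) *ᵥ k = 0 := by
      rw [sub_mulVec, smul_mulVec, hAk, hker k hAk, smul_zero, sub_zero]
    have hkM : star k ᵥ* ((c : ℂ) • A - B) = 0 := by
      rw [← hH.eq, ← star_mulVec, hMk, star_zero]
    rw [mulVec_add, hMk, zero_add, star_add, add_dotProduct, dotProduct_mulVec, hkM,
      zero_dotProduct, zero_add, Complex.nonneg_iff]
    exact ⟨hWnonneg w hw, (im_eq_zero hH w).symm⟩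

open Matrix in
/-- The normalized rank-one projection onto a nonzero vector is at most the identity. -/
theorem Matrix.posSemidef_one_sub_inv_smul_vecMulVec {ι : Type*} [Fintype ι] [DecidableEq ι]
    {v : ι → ℂ} (hv : v ≠ 0) :
    (1 - (star v ⬝ᵥ v)⁻¹ • vecMulVec v (star v)).PosSemidef := by
  set P := (star v ⬝ᵥ v)⁻¹ • vecMulVec v (star v) with hP
  have hs : star v ⬝ᵥ v ≠ 0 := by simpa using hv
  have hstar : star (star v ⬝ᵥ v) = star v ⬝ᵥ v := by
    rw [← star_dotProduct]
  have hH : Pᴴ = P := by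
    rw [hP, conjTranspose_smul, conjTranspose_vecMulVec, star_star, star_inv₀, hstar]
  have hPP : P * P = P := by
    rw [hP, smul_mul_smul_comm, vecMulVec_mul_vecMulVec, vecMulVec_smul, smul_smul, mul_assoc,
      inv_mul_cancel₀ hs, mul_one]
  have h : 1 - P = (1 - P)ᴴ * (1 - P) := by
    rw [conjTranspose_sub, conjTranspose_one, hH, mul_sub, sub_mul, sub_mul, hPP]
    simp
  rw [h]
  exact posSemidef_conjTranspose_mul_self _

/-- the maximum confidence over all measurements to identify `ρ j`
equals `min {q | q • ρ₀ - η j • ρ j is positive semidefinite}`. -/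
theorem maxConfidence_eq_min_posSemidef
    {ι : Type*} [Fintype ι] [DecidableEq ι] {n : ℕ}
    (η : Fin n → ℝ) (ρ : Fin n → Matrix ι ι ℂ)
    (hηpos : ∀ i, 0 < η i) (hηsum : ∑ i, η i = 1) (hρ : ∀ i, IsState (ρ i))
    (j : Fin n) (ρ₀ : Matrix ι ι ℂ) (hρ₀ : ρ₀ = ∑ i, (η i : ℂ) • ρ i) :
    ∃ c : ℝ,
      IsGreatest {x : ℝ |
        ∃ M : Fin (n + 1) → Matrix ι ι ℂ,
          (∀ i, (M i).PosSemidef) ∧ (∑ i, M i = 1) ∧ (ρ₀ * M j.succ).trace ≠ 0 ∧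
          x = η j * ((ρ j * M j.succ).trace.re) / ((ρ₀ * M j.succ).trace.re)} c ∧
      IsLeast {t : ℝ | ((t : ℂ) • ρ₀ - (η j : ℂ) • ρ j).PosSemidef} c := by
  have hη (i : Fin n) : (0 : ℂ) ≤ (η i : ℂ) := by exact_mod_cast (hηpos i).le
  have hpsd (i : Fin n) : ((η i : ℂ) • ρ i).PosSemidef := (hρ i).1.smul (hη i)
  have hρ₀psd : ρ₀.PosSemidef := hρ₀ ▸ Matrix.posSemidef_sum _ fun i _ ↦ hpsd i
  have hsub : (ρ₀ - (η j : ℂ) • ρ j).PosSemidef := by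
    rw [hρ₀, ← Finset.add_sum_erase _ _ (Finset.mem_univ j), add_sub_cancel_left]
    exact Matrix.posSemidef_sum _ fun i _ ↦ hpsd i
  have htr : ρ₀.trace = 1 := by
    simp only [hρ₀, Matrix.trace_sum, Matrix.trace_smul, (hρ _).2, smul_eq_mul, mul_one]
    exact_mod_cast hηsum
  have hρ₀0 : ρ₀ ≠ 0 := fun h ↦ by simp [h] at htr
  obtain ⟨c, v, hvA, hv, hc⟩ := hρ₀psd.exists_isMax_rayleighQuotient (hpsd j).1 hρ₀0
    fun _ ↦ (hpsd j).mulVec_eq_zero_of_sub hsub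
  have hre (t : ℝ) (M : Matrix ι ι ℂ) : ((((t : ℂ) • ρ₀ - (η j : ℂ) • ρ j) * M).trace).re =
      t * (ρ₀ * M).trace.re - η j * (ρ j * M).trace.re := by
    simp [sub_mul]
  have hpos {M : Matrix ι ι ℂ} (hM : M.PosSemidef) (h : (ρ₀ * M).trace ≠ 0) :
      0 < (ρ₀ * M).trace.re :=
    (Complex.pos_iff.mp ((hρ₀psd.trace_mul_nonneg hM).lt_of_ne h.symm)).1
  have hv0 : v ≠ 0 := by
    rintro rfl
    simp at hvA
  have hs : (star v ⬝ᵥ v)⁻¹ ≠ 0 := by simpa using hv0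
  have htrace (A : Matrix ι ι ℂ) : (A * ((star v ⬝ᵥ v)⁻¹ • Matrix.vecMulVec v (star v))).trace =
      (star v ⬝ᵥ v)⁻¹ * (star v ⬝ᵥ A.mulVec v) := by
    rw [Matrix.mul_smul, Matrix.trace_smul, Matrix.mul_vecMulVec, Matrix.trace_vecMulVec,
      dotProduct_comm _ (star v), smul_eq_mul]
  have hPpsd : ((star v ⬝ᵥ v)⁻¹ • Matrix.vecMulVec v (star v)).PosSemidef :=
    (Matrix.posSemidef_vecMulVec_self_star v).smul
      (inv_nonneg.mpr (dotProduct_star_self_nonneg v))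
  set P := (star v ⬝ᵥ v)⁻¹ • Matrix.vecMulVec v (star v)
  have hweak : ∀ t : ℝ, ((t : ℂ) • ρ₀ - (η j : ℂ) • ρ j).PosSemidef →
      ∀ M : Matrix ι ι ℂ, M.PosSemidef → (ρ₀ * M).trace ≠ 0 →
        η j * (ρ j * M).trace.re / (ρ₀ * M).trace.re ≤ t := by
    intro t ht M hM h
    have hnonneg := (Complex.nonneg_iff.mp (ht.trace_mul_nonneg hM)).1
    rw [hre] at hnonneg
    exact (div_le_iff₀ (hpos hM h)).mpr (sub_nonneg.mp hnonneg)
  have hPtr : (ρ₀ * P).trace ≠ 0 := by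
    rw [htrace]
    exact mul_ne_zero hs hvA
  have hcP : c = η j * (ρ j * P).trace.re / (ρ₀ * P).trace.re := by
    rw [eq_div_iff (hpos hPpsd hPtr).ne', ← sub_eq_zero, ← hre, htrace, hv, mul_zero,
      Complex.zero_re]
  refine ⟨c, ⟨⟨Fin.cons (1 - P) (Pi.single j P), ?_, ?_, ?_, ?_⟩, ?_⟩, hc, ?_⟩
  · refine Fin.cases (Matrix.posSemidef_one_sub_inv_smul_vecMulVec hv0) fun i ↦ ?_
    rcases eq_or_ne i j with rfl | hij
    · simpa using hPpsd
    · simpa [hij] using Matrix.PosSemidef.zero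
  · simp [Fin.sum_univ_succ]
  · simpa using hPtr
  · simpa using hcP
  · rintro x ⟨M, hM, -, h, rfl⟩
    exact hweak c hc _ (hM _) h
  · intro t ht
    rw [hcP]
    exact hweak t ht P hPpsd hPtr
end

section
/- Let W_1, ..., W_n be entanglement witnesses on a multipartite Hilbert space, let W = Σ_{i=1}^n W_i, and suppose the smallest eigenvalue ε of W is strictly positive. For each i, let λ_i be the largest eigenvalue of W_i and set λ = Σ_i λ_i. Define the ensemble E = {(η_i, ρ_i)}_{i=1}^n by η_i = Tr(λ_i W − ε W_i)/Tr(λW − εW) and ρ_i = (λ_i W − ε W_i)/Tr(λ_i W − ε W_i) (each λ_i W − ε W_i is positive semidefinite with positive trace, so this is a valid ensemble). Then for every j ∈ {1,...,n}: Q_j(E) ≤ λ_j/(λ − ε) < C_j(E); i.e., the maximum confidence to identify each ρ_j is not achievable by separable measurements. -/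
open ComplexOrder

/-- The product operator `σ 1 ⊗ ⋯ ⊗ σ m` on the multipartite space
`⨂ k, ℂ^(d k)`, realized as a matrix indexed by tuples. -/
noncomputable def prodMat {m : ℕ} (d : Fin m → ℕ)
    (σ : ∀ k : Fin m, Matrix (Fin (d k)) (Fin (d k)) ℂ) :
    Matrix (∀ k, Fin (d k)) (∀ k, Fin (d k)) ℂ :=
  Matrix.of fun x y => ∏ k, σ k (x k) (y k)

/-- A separable operator: a conic combination of product states. -/
def IsSep {m : ℕ} {d : Fin m → ℕ}
    (E : Matrix (∀ k, Fin (d k)) (∀ k, Fin (d k)) ℂ) : Prop :=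
  ∃ (L : ℕ) (p : Fin L → ℝ)
    (σ : Fin L → ∀ k : Fin m, Matrix (Fin (d k)) (Fin (d k)) ℂ),
    (∀ l, 0 ≤ p l) ∧ (∀ l k, IsState (σ l k)) ∧
    E = ∑ l, (p l : ℂ) • prodMat d (σ l)

/-- A block-positive Hermitian operator: `Tr (E * F) ≥ 0` for every separable `F`. -/
def IsBlockPos {m : ℕ} {d : Fin m → ℕ}
    (E : Matrix (∀ k, Fin (d k)) (∀ k, Fin (d k)) ℂ) : Prop :=
  E.IsHermitian ∧ ∀ F, IsSep F → 0 ≤ (E * F).trace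

lemma prodMat_smul_one {m : ℕ} (d : Fin m → ℕ) (c : Fin m → ℂ) :
    prodMat d (fun k => c k • (1 : Matrix (Fin (d k)) (Fin (d k)) ℂ)) = (∏ k, c k) • 1 := by
  ext x y
  simp only [prodMat, Matrix.of_apply, Matrix.smul_apply, smul_eq_mul, Matrix.one_apply,
    Finset.prod_mul_distrib]
  congr 1
  by_cases h : x = y
  · simp [h]
  · obtain ⟨k, hk⟩ := Function.ne_iff.mp h
    rw [if_neg h]
    exact Finset.prod_eq_zero (Finset.mem_univ k) (if_neg hk)

/-- The identity is separable: it is a multiple of the maximally mixed product state. -/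
lemma isSep_one {m : ℕ} {d : Fin m → ℕ} (hd : ∀ k, 0 < d k) :
    IsSep (1 : Matrix (∀ k, Fin (d k)) (∀ k, Fin (d k)) ℂ) := by
  have hne : ∀ k, (d k : ℂ) ≠ 0 := fun k => Nat.cast_ne_zero.mpr (hd k).ne'
  refine ⟨1, fun _ => ∏ k, (d k : ℝ), fun _ k => (d k : ℂ)⁻¹ • 1,
    fun _ => Finset.prod_nonneg fun k _ => Nat.cast_nonneg _, fun _ k => ⟨?_, ?_⟩, ?_⟩
  · refine Matrix.PosSemidef.one.smul ?_
    rw [show (d k : ℂ)⁻¹ = (((d k : ℝ)⁻¹ : ℝ) : ℂ) by push_cast; rfl]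
    exact Complex.zero_le_real.mpr (by positivity)
  · simp [Matrix.trace_smul, hne k]
  · rw [Fin.sum_univ_one, prodMat_smul_one, smul_smul]
    push_cast
    rw [← Finset.prod_mul_distrib, Finset.prod_eq_one fun k _ => mul_inv_cancel₀ (hne k),
      one_smul]

lemma IsBlockPos.trace_nonneg {m : ℕ} {d : Fin m → ℕ} (hd : ∀ k, 0 < d k)
    {E : Matrix (∀ k, Fin (d k)) (∀ k, Fin (d k)) ℂ} (hE : IsBlockPos E) : 0 ≤ E.trace := by
  simpa using hE.2 1 (isSep_one hd)

lemma Matrix.PosSemidef.ofReal_smul {ι : Type*} {A : Matrix ι ι ℂ} (hA : A.PosSemidef)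
    {c : ℝ} (hc : 0 ≤ c) : ((c : ℂ) • A).PosSemidef :=
  hA.smul (Complex.zero_le_real.mpr hc)

lemma IsBlockPos.ofReal_smul {m : ℕ} {d : Fin m → ℕ}
    {E : Matrix (∀ k, Fin (d k)) (∀ k, Fin (d k)) ℂ} (hE : IsBlockPos E)
    {c : ℝ} (hc : 0 ≤ c) : IsBlockPos ((c : ℂ) • E) := by
  refine ⟨?_, fun F hF => ?_⟩
  · rw [Matrix.IsHermitian, Matrix.conjTranspose_smul, hE.1]
    simp
  · rw [Matrix.smul_mul, Matrix.trace_smul, smul_eq_mul]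
    exact mul_nonneg (Complex.zero_le_real.mpr hc) (hE.2 F hF)

/-- Every upper spectral bound of an entanglement witness is positive. -/
lemma IsBlockPos.pos_of_posSemidef_sub {m : ℕ} {d : Fin m → ℕ} (hd : ∀ k, 0 < d k)
    {E : Matrix (∀ k, Fin (d k)) (∀ k, Fin (d k)) ℂ} (hE : IsBlockPos E)
    (hE' : ¬ E.PosSemidef) {t : ℝ} (ht : ((t : ℂ) • 1 - E).PosSemidef) : 0 < t := by
  by_contra! h
  have hneg : (-E).PosSemidef := by
    have h1 := ht.add (Matrix.PosSemidef.one.ofReal_smul (neg_nonneg.mpr h))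
    convert h1 using 1
    push_cast
    module
  have htr : (-E).trace = 0 :=
    le_antisymm (by simpa using hE.trace_nonneg hd) hneg.trace_nonneg
  rw [hneg.trace_eq_zero_iff, neg_eq_zero] at htr
  exact hE' (htr ▸ Matrix.PosSemidef.zero)

/-- for the ensemble built from entanglement witnesses `Wf i` via
`η i = Tr(λ i • W - ε • Wf i)/Tr(Λ • W - ε • W)`, `ρ i = (λ i • W - ε • Wf i)/Tr(⋯)`,
every maximum confidence is nonlocal: `Q j ≤ λ j / (Λ - ε) < C j`. -/
theorem ensemble_from_EW_family_nonlocal_confidence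
    {m : ℕ} (hm : 2 ≤ m) {d : Fin m → ℕ} (hd : ∀ k, 0 < d k) {n : ℕ}
    (Wf : Fin n → Matrix (∀ k, Fin (d k)) (∀ k, Fin (d k)) ℂ)
    (hEW : ∀ i, IsBlockPos (Wf i) ∧ ¬ (Wf i).PosSemidef)
    (W : Matrix (∀ k, Fin (d k)) (∀ k, Fin (d k)) ℂ) (hW : W = ∑ i, Wf i)
    (ε : ℝ) (hε : IsGreatest {t : ℝ | (W - (t : ℂ) • 1).PosSemidef} ε) (hεpos : 0 < ε)
    (lam : Fin n → ℝ)
    (hlam : ∀ i, IsLeast {t : ℝ | ((t : ℂ) • 1 - Wf i).PosSemidef} (lam i))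
    (lamSum : ℝ) (hlamSum : lamSum = ∑ i, lam i)
    (η : Fin n → ℝ) (ρ : Fin n → Matrix (∀ k, Fin (d k)) (∀ k, Fin (d k)) ℂ)
    (hη : ∀ i, η i = ((lam i : ℂ) • W - (ε : ℂ) • Wf i).trace.re /
        ((lamSum : ℂ) • W - (ε : ℂ) • W).trace.re)
    (hρ : ∀ i, ρ i = (((lam i : ℂ) • W - (ε : ℂ) • Wf i).trace)⁻¹ •
        ((lam i : ℂ) • W - (ε : ℂ) • Wf i))
    (ρ₀ : Matrix (∀ k, Fin (d k)) (∀ k, Fin (d k)) ℂ)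
    (hρ₀ : ρ₀ = ∑ i, (η i : ℂ) • ρ i) :
    ∀ j : Fin n, ∀ Q C : ℝ,
      IsLeast {t : ℝ | IsBlockPos ((t : ℂ) • ρ₀ - (η j : ℂ) • ρ j)} Q →
      IsLeast {t : ℝ | ((t : ℂ) • ρ₀ - (η j : ℂ) • ρ j).PosSemidef} C →
      Q ≤ lam j / (lamSum - ε) ∧ lam j / (lamSum - ε) < C := by
  intro j Q C hQ hC
  have hWpos : W.PosSemidef := by
    convert hε.1.add (Matrix.PosSemidef.one.ofReal_smul hεpos.le) using 1
    module
  have hlampos : ∀ i, 0 < lam i := fun i =>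
    (hEW i).1.pos_of_posSemidef_sub hd (hEW i).2 (hlam i).1
  set A : Fin n → Matrix (∀ k, Fin (d k)) (∀ k, Fin (d k)) ℂ :=
    fun i => (lam i : ℂ) • W - (ε : ℂ) • Wf i with hA
  have hApos : ∀ i, (A i).PosSemidef := fun i => by
    have hmem : ((lam i : ℂ) • 1 - Wf i).PosSemidef := (hlam i).1
    have hmem' : (W - (ε : ℂ) • 1).PosSemidef := hε.1
    convert (hmem'.ofReal_smul (hlampos i).le).add (hmem.ofReal_smul hεpos.le) using 1
    simp only [hA]
    module
  have hAtr : ∀ i, 0 < (A i).trace := fun i => by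
    refine lt_of_le_of_ne (hApos i).trace_nonneg fun h => (hEW i).2 ?_
    have h0 : A i = 0 := (hApos i).trace_eq_zero_iff.mp h.symm
    have hε' : (ε : ℂ) ≠ 0 := Complex.ofReal_ne_zero.mpr hεpos.ne'
    have h1 : (lam i : ℂ) • W = (ε : ℂ) • Wf i := sub_eq_zero.mp h0
    have h2 : Wf i = ((lam i / ε : ℝ) : ℂ) • W := by
      rw [← inv_smul_smul₀ hε' (Wf i), ← h1, smul_smul]
      push_cast
      rw [div_eq_inv_mul]
    rw [h2]
    exact hWpos.ofReal_smul (div_pos (hlampos i) hεpos).le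
  have hSum : ∑ i, A i = (lamSum : ℂ) • W - (ε : ℂ) • W := by
    simp only [hA, Finset.sum_sub_distrib, ← Finset.sum_smul, ← Finset.smul_sum, ← hW, hlamSum]
    push_cast
    rfl
  set T : ℝ := ((lamSum : ℂ) • W - (ε : ℂ) • W).trace.re with hT
  have hTpos : 0 < T := by
    rw [hT, ← hSum, Matrix.trace_sum, Complex.re_sum]
    exact Finset.sum_pos (fun i _ => (Complex.pos_iff.mp (hAtr i)).1) ⟨j, Finset.mem_univ j⟩
  have hdiff : 0 < lamSum - ε := by
    have h1 : T = (lamSum - ε) * W.trace.re := by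
      rw [hT, ← sub_smul, Matrix.trace_smul, smul_eq_mul, ← Complex.ofReal_sub,
        Complex.re_ofReal_mul]
    exact pos_of_mul_pos_left (h1 ▸ hTpos) (Complex.nonneg_iff.mp hWpos.trace_nonneg).1
  have hηρ : ∀ i, (η i : ℂ) • ρ i = ((T⁻¹ : ℝ) : ℂ) • A i := fun i => by
    have hre : (((A i).trace.re : ℝ) : ℂ) = (A i).trace :=
      Complex.ext rfl (Complex.pos_iff.mp (hAtr i)).2
    have hη' : η i = (A i).trace.re / T := hη i
    have hρ' : ρ i = ((A i).trace)⁻¹ • A i := hρ i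
    rw [hη', hρ', smul_smul]
    congr 1
    rw [Complex.ofReal_div, hre, div_mul_eq_mul_div, mul_inv_cancel₀ (hAtr i).ne']
    push_cast
    rw [one_div]
  have hρ₀' : ρ₀ = (((lamSum - ε) / T : ℝ) : ℂ) • W := by
    rw [hρ₀, Finset.sum_congr rfl fun i _ => hηρ i, ← Finset.smul_sum, hSum, ← sub_smul,
      smul_smul]
    push_cast
    rw [div_eq_inv_mul]
  have hcrit : ((lam j / (lamSum - ε) : ℝ) : ℂ) • ρ₀ - (η j : ℂ) • ρ j =
      ((ε / T : ℝ) : ℂ) • Wf j := by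
    have h1 : lam j / (lamSum - ε) * ((lamSum - ε) / T) = T⁻¹ * lam j := by
      field_simp
    rw [hηρ, hρ₀', smul_smul, ← Complex.ofReal_mul, h1]
    simp only [hA, div_eq_mul_inv]
    push_cast
    module
  refine ⟨hQ.2 ?_, ?_⟩
  · rw [Set.mem_ofPred_eq, hcrit]
    exact (hEW j).1.ofReal_smul (div_pos hεpos hTpos).le
  · by_contra! hle
    have hρ₀pos : ρ₀.PosSemidef := hρ₀' ▸ hWpos.ofReal_smul (div_pos hdiff hTpos).le
    have hmem : ((C : ℂ) • ρ₀ - (η j : ℂ) • ρ j).PosSemidef := hC.1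
    have h1 : (((ε / T : ℝ) : ℂ) • Wf j).PosSemidef := by
      rw [← hcrit]
      convert hmem.add (hρ₀pos.ofReal_smul (sub_nonneg.mpr hle)) using 1
      rw [Complex.ofReal_sub]
      module
    refine (hEW j).2 ?_
    have h2 := h1.ofReal_smul (div_pos hTpos hεpos).le
    rwa [smul_smul, ← Complex.ofReal_mul, div_mul_div_cancel₀ hεpos.ne', div_self hTpos.ne',
      Complex.ofReal_one, one_smul] at h2
end
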